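/- Let p, q > 0 with p + q > 2, and let f be a function analytic on the domain D^b := ℂ∖((−∞,0] ∪ [1,∞)) such that f(z) = G_{β_{p,q}}(z) for all z in the upper half-plane ℂ⁺. Then for every z ∈ D^b with Im f(z) < 0, the derivative f'(z) is nonzero. -/

import Mathlib

open MeasureTheory Complex Set

/-- The Cauchy transform `∫ 1/(z-x) dμ(x)` of a measure on ℝ. -/
noncomputable def cauchyT (μ : Measure ℝ) (z : ℂ) : ℂ := ∫ x, (z - (x : ℂ))⁻¹ ∂μ

/-- The Euler beta function `B(p,q) = ∫₀¹ x^(p-1) (1-x)^(q-1) dx`. -/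
noncomputable def betaFun (p q : ℝ) : ℝ := ∫ x in Ioo (0:ℝ) 1, x ^ (p - 1) * (1 - x) ^ (q - 1)

/-- The beta distribution `β_{p,q}` on `[0,1]`. -/
noncomputable def betaMeasure (p q : ℝ) : Measure ℝ :=
  volume.withDensity fun x =>
    ENNReal.ofReal ((Ioo (0:ℝ) 1).indicator
      (fun x => x ^ (p - 1) * (1 - x) ^ (q - 1) / betaFun p q) x)

/-- The domain `D^b = ℂ ∖ ((-∞,0] ∪ [1,∞))`. -/
def betaDomain : Set ℂ := {z : ℂ | ¬ (z.im = 0 ∧ (z.re ≤ 0 ∨ 1 ≤ z.re))}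

/-- The kernel of the beta integral is integrable on `(0,1)`. -/
lemma integrableOn_rpow_mul_one_sub_rpow {p q : ℝ} (hp : 0 < p) (hq : 0 < q) :
    IntegrableOn (fun x : ℝ => x ^ (p - 1) * (1 - x) ^ (q - 1)) (Ioo 0 1) := by
  have h := (betaIntegral_convergent (u := p) (v := q) (by simpa) (by simpa))
  rw [intervalIntegrable_iff_integrableOn_Ioo_of_le zero_le_one] at h
  refine h.re.congr ?_
  filter_upwards [ae_restrict_mem measurableSet_Ioo] with x hx
  have h1 : (x : ℂ) ^ ((p : ℂ) - 1) = ((x ^ (p - 1) : ℝ) : ℂ) := by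
    rw [ofReal_cpow hx.1.le]; simp
  have h2 : (1 - (x : ℂ)) ^ ((q : ℂ) - 1) = (((1 - x) ^ (q - 1) : ℝ) : ℂ) := by
    rw [ofReal_cpow (by linarith [hx.2])]; simp
  simp only [h1, h2, ← ofReal_mul]
  simp

lemma betaFun_pos {p q : ℝ} (hp : 0 < p) (hq : 0 < q) : 0 < betaFun p q := by
  have hpos : ∀ x ∈ Ioo (0 : ℝ) 1, 0 < x ^ (p - 1) * (1 - x) ^ (q - 1) := fun x hx =>
    mul_pos (Real.rpow_pos_of_pos hx.1 _) (Real.rpow_pos_of_pos (by linarith [hx.2]) _)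
  rw [betaFun, setIntegral_pos_iff_support_of_nonneg_ae]
  · rw [inter_eq_self_of_subset_right fun x hx => Function.mem_support.2 (hpos x hx).ne']
    simp
  · filter_upwards [ae_restrict_mem measurableSet_Ioo] with x hx using (hpos x hx).le
  · exact integrableOn_rpow_mul_one_sub_rpow hp hq

/-- The density of the beta distribution is measurable. -/
lemma measurable_betaDensity (p q : ℝ) : Measurable ((Ioo (0:ℝ) 1).indicator
    (fun x => x ^ (p - 1) * (1 - x) ^ (q - 1) / betaFun p q)) :=
  Measurable.indicator (by fun_prop) measurableSet_Ioo

lemma betaDensity_nonneg {p q : ℝ} (hp : 0 < p) (hq : 0 < q) (x : ℝ) :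
    0 ≤ (Ioo (0:ℝ) 1).indicator
      (fun x => x ^ (p - 1) * (1 - x) ^ (q - 1) / betaFun p q) x := by
  refine indicator_nonneg (fun x hx => ?_) x
  have := betaFun_pos hp hq
  have h1 := Real.rpow_nonneg hx.1.le (p - 1)
  have h2 := Real.rpow_nonneg (sub_nonneg.2 hx.2.le) (q - 1)
  positivity

lemma isProbabilityMeasure_betaMeasure {p q : ℝ} (hp : 0 < p) (hq : 0 < q) :
    IsProbabilityMeasure (betaMeasure p q) := by
  constructor
  rw [betaMeasure, withDensity_apply _ MeasurableSet.univ, Measure.restrict_univ,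
    ← ofReal_integral_eq_lintegral_ofReal _ (.of_forall (betaDensity_nonneg hp hq)),
    integral_indicator measurableSet_Ioo, integral_div, ← betaFun,
    div_self (betaFun_pos hp hq).ne', ENNReal.ofReal_one]
  rw [integrable_indicator_iff measurableSet_Ioo]
  exact (integrableOn_rpow_mul_one_sub_rpow hp hq).div_const _

lemma integral_betaMeasure {p q : ℝ} (hp : 0 < p) (hq : 0 < q) (g : ℝ → ℂ) :
    ∫ x, g x ∂(betaMeasure p q) = (betaFun p q : ℂ)⁻¹ *
      ∫ x in (0:ℝ)..1, ((x ^ (p - 1) * (1 - x) ^ (q - 1) : ℝ) : ℂ) * g x := by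
  rw [betaMeasure, integral_withDensity_eq_integral_toReal_smul
    (measurable_betaDensity p q).ennreal_ofReal (by simp),
    intervalIntegral.integral_of_le zero_le_one, integral_Ioc_eq_integral_Ioo,
    ← integral_const_mul, ← integral_indicator measurableSet_Ioo]
  refine integral_congr_ae (.of_forall fun x => ?_)
  simp only [ENNReal.toReal_ofReal (betaDensity_nonneg hp hq x)]
  by_cases hx : x ∈ Ioo (0:ℝ) 1
  · simp only [indicator_of_mem hx, real_smul, div_eq_inv_mul]
    push_cast
    ring
  · simp [indicator_of_notMem hx]

lemma sub_ofReal_ne_zero {z : ℂ} (hz : 0 < z.im) (x : ℝ) : z - x ≠ 0 := by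
  intro h
  have := congrArg im h
  simp at this
  exact hz.ne' this

lemma norm_inv_sub_ofReal_le {z : ℂ} {c : ℝ} (hc : 0 < c) (hz : c ≤ z.im) (x : ℝ) :
    ‖(z - (x : ℂ))⁻¹‖ ≤ c⁻¹ := by
  rw [norm_inv]
  refine inv_anti₀ hc (hz.trans ?_)
  have := (le_abs_self _).trans (abs_im_le_norm (z - (x : ℂ)))
  simpa using this

section CauchyTransform

variable {μ : Measure ℝ} {z : ℂ}

lemma integrable_inv_sub_ofReal [IsFiniteMeasure μ] (hz : 0 < z.im) :
    Integrable (fun x : ℝ => (z - (x : ℂ))⁻¹) μ :=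
  Integrable.of_bound (by fun_prop : Measurable _).aestronglyMeasurable (z.im)⁻¹
    (.of_forall fun x => norm_inv_sub_ofReal_le hz le_rfl x)

lemma integrable_inv_sub_ofReal_sq [IsFiniteMeasure μ] (hz : 0 < z.im) :
    Integrable (fun x : ℝ => (z - (x : ℂ))⁻¹ ^ 2) μ :=
  Integrable.of_bound (by fun_prop : Measurable _).aestronglyMeasurable ((z.im)⁻¹ ^ 2)
    (.of_forall fun x => by
      rw [norm_pow]
      exact pow_le_pow_left₀ (norm_nonneg _) (norm_inv_sub_ofReal_le hz le_rfl x) 2)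

lemma hasDerivAt_cauchyT [IsFiniteMeasure μ] (hz : 0 < z.im) :
    HasDerivAt (cauchyT μ) (∫ x, -(z - (x : ℂ))⁻¹ ^ 2 ∂μ) z := by
  have hU : {w : ℂ | z.im / 2 < w.im} ∈ nhds z :=
    (isOpen_lt continuous_const continuous_im).mem_nhds (by simpa using hz)
  refine (hasDerivAt_integral_of_dominated_loc_of_deriv_le (𝕜 := ℂ)
    (F := fun w (x : ℝ) => (w - (x : ℂ))⁻¹)
    (F' := fun w (x : ℝ) => -(w - (x : ℂ))⁻¹ ^ 2)
    (bound := fun _ => ((z.im / 2)⁻¹) ^ 2) hU ?_ (integrable_inv_sub_ofReal hz)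
    (integrable_inv_sub_ofReal_sq hz).neg.aestronglyMeasurable ?_ (integrable_const _) ?_).2
  · exact .of_forall fun w => (by fun_prop : Measurable _).aestronglyMeasurable
  · refine .of_forall fun x w hw => ?_
    rw [norm_neg, norm_pow]
    exact pow_le_pow_left₀ (norm_nonneg _) (norm_inv_sub_ofReal_le (half_pos hz) (le_of_lt hw) x) 2
  · refine .of_forall fun x w hw => ?_
    have hw0 : 0 < w.im := (half_pos hz).trans hw
    have := ((hasDerivAt_id w).sub_const (x : ℂ)).inv (sub_ofReal_ne_zero hw0 x)
    convert! this using 1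
    simp [div_eq_mul_inv]

/-- The reciprocal Cauchy transform of a probability measure does not decrease imaginary parts. -/
lemma im_mul_normSq_cauchyT_le [IsProbabilityMeasure μ] (hz : 0 < z.im) :
    z.im * normSq (cauchyT μ z) ≤ -(cauchyT μ z).im := by
  have key : ∀ w : ℂ, w ∈ Metric.closedBall (⟨0, -(2 * z.im)⁻¹⟩ : ℂ) (2 * z.im)⁻¹ ↔
      z.im * normSq w ≤ -w.im := by
    intro w
    rw [mem_closedBall_iff_norm, ← sq_le_sq₀ (norm_nonneg _) (by positivity), ← normSq_eq_norm_sq,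
      normSq_apply, normSq_apply]
    have e : (w - ⟨0, -(2 * z.im)⁻¹⟩).re * (w - ⟨0, -(2 * z.im)⁻¹⟩).re +
        (w - ⟨0, -(2 * z.im)⁻¹⟩).im * (w - ⟨0, -(2 * z.im)⁻¹⟩).im - ((2 * z.im)⁻¹) ^ 2 =
        (z.im)⁻¹ * (z.im * (w.re * w.re + w.im * w.im) - -w.im) := by
      simp only [sub_re, sub_im]
      field_simp
      ring
    rw [← sub_nonpos, e, ← sub_nonpos (b := -w.im)]
    exact smul_nonpos_iff_nonpos_of_pos_left (inv_pos.2 hz)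
  refine (key _).1 ((convex_closedBall _ _).integral_mem Metric.isClosed_closedBall
    (.of_forall fun x => (key _).2 ?_) (integrable_inv_sub_ofReal hz))
  have h0 := normSq_pos.2 (sub_ofReal_ne_zero hz x)
  rw [normSq_inv, inv_im, sub_im, ofReal_im, sub_zero]
  exact le_of_eq (by ring)

end CauchyTransform

lemma integral_betaMeasure_deriv_eq_zero {p q : ℝ} (hp : 0 < p) (hq : 0 < q) {z : ℂ}
    (hz : 0 < z.im) :
    ∫ x : ℝ, ((p - (p + q) * x) * (z - (x : ℂ))⁻¹ + x * (1 - x) * (z - (x : ℂ))⁻¹ ^ 2)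
      ∂(betaMeasure p q) = 0 := by
  rw [integral_betaMeasure hp hq]
  have hinv : Continuous fun x : ℝ => (z - (x : ℂ))⁻¹ :=
    Continuous.inv₀ (by fun_prop) (sub_ofReal_ne_zero hz)
  rw [intervalIntegral.integral_eq_sub_of_hasDerivAt_of_le zero_le_one
    (f := fun x : ℝ => ((x ^ p * (1 - x) ^ q : ℝ) : ℂ) * (z - (x : ℂ))⁻¹)]
  · simp [Real.zero_rpow hp.ne', Real.zero_rpow hq.ne']
  · refine Continuous.continuousOn (Continuous.mul (continuous_ofReal.comp ?_) hinv)
    exact (Real.continuous_rpow_const hp.le).mul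
      ((Real.continuous_rpow_const hq.le).comp (by fun_prop))
  · intro x hx
    have hx1 : 0 < 1 - x := by linarith [hx.2]
    have d1 := Real.hasDerivAt_rpow_const (x := x) (p := p) (Or.inl hx.1.ne')
    have d2 := ((hasDerivAt_id x).const_sub 1).rpow_const (p := q) (Or.inl hx1.ne')
    have d3 := (((hasDerivAt_id x).ofReal_comp).const_sub z).inv (sub_ofReal_ne_zero hz x)
    have d4 := (d1.mul d2).ofReal_comp.mul d3
    convert! d4 using 1
    have e1 : x ^ p = x * x ^ (p - 1) := by
      rw [Real.rpow_sub_one hx.1.ne']; field_simp [hx.1.ne']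
    have e2 : (1 - x) ^ q = (1 - x) * (1 - x) ^ (q - 1) := by
      rw [Real.rpow_sub_one hx1.ne']; field_simp [hx1.ne']
    simp only [id, e1, e2, Pi.mul_apply, Pi.inv_apply]
    push_cast
    simp only [div_eq_mul_inv, ← inv_pow]
    ring
  · rw [intervalIntegrable_iff_integrableOn_Icc_of_le zero_le_one,
      integrableOn_Icc_iff_integrableOn_Ioo]
    refine IntegrableOn.mul_continuousOn_of_subset
      (integrableOn_rpow_mul_one_sub_rpow hp hq).ofReal (Continuous.continuousOn ?_)
      measurableSet_Ioo isCompact_Icc Ioo_subset_Icc_self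
    exact ((by fun_prop : Continuous _).mul hinv).add
      ((by fun_prop : Continuous _).mul (hinv.pow 2))

/-- The first-order linear differential equation satisfied by the Cauchy transform. -/
lemma deriv_cauchyT_betaMeasure {p q : ℝ} (hp : 0 < p) (hq : 0 < q) {z : ℂ} (hz : 0 < z.im) :
    z * (1 - z) * deriv (cauchyT (betaMeasure p q)) z =
      ((p - 1) - (p + q - 2) * z) * cauchyT (betaMeasure p q) z + (p + q - 1) := by
  have := isProbabilityMeasure_betaMeasure hp hq
  have i1 := integrable_inv_sub_ofReal (μ := betaMeasure p q) hz
  have i2 := integrable_inv_sub_ofReal_sq (μ := betaMeasure p q) hz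
  have h := integral_betaMeasure_deriv_eq_zero hp hq hz
  have e : ∀ x : ℝ,
      (p - (p + q) * x) * (z - (x : ℂ))⁻¹ + x * (1 - x) * (z - (x : ℂ))⁻¹ ^ 2 =
      (p - 1 - (p + q - 2) * z) * (z - (x : ℂ))⁻¹ + z * (1 - z) * (z - (x : ℂ))⁻¹ ^ 2
        + (p + q - 1) := by
    intro x
    have := sub_ofReal_ne_zero hz x
    field_simp
    ring
  simp only [e] at h
  rw [integral_add (by exact (i1.const_mul _).add (i2.const_mul _)) (integrable_const _),
    integral_add (i1.const_mul _) (i2.const_mul _), integral_const_mul, integral_const_mul,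
    integral_const] at h
  rw [(hasDerivAt_cauchyT hz).deriv, integral_neg, cauchyT]
  simp at h
  simp only [inv_pow]
  linear_combination -h

lemma isPreconnected_betaDomain : IsPreconnected betaDomain := by
  have h : StarConvex ℝ (1 / 2 : ℂ) betaDomain := by
    intro w hw a b ha hb hab
    simp only [betaDomain, mem_ofPred_eq] at hw ⊢
    simp only [real_smul, add_im, mul_im, ofReal_re, ofReal_im, add_re, mul_re]
    norm_num
    intro h0
    rcases h0 with rfl | h0
    · constructor <;> linarith
    · rw [not_and] at hw
      have := hw h0
      push Not at this
      constructor <;> nlinarith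
  have h0 : (1 / 2 : ℂ) ∈ betaDomain := by
    simp only [betaDomain, mem_ofPred_eq]
    norm_num
  exact (h.isPathConnected h0).isConnected.isPreconnected

theorem stmt_12 (p q : ℝ) (hp : 0 < p) (hq : 0 < q) (hpq : 2 < p + q)
    (f : ℂ → ℂ) (hf : AnalyticOnNhd ℂ f betaDomain)
    (hagree : ∀ z : ℂ, 0 < z.im → f z = cauchyT (betaMeasure p q) z)
    (z : ℂ) (hzD : z ∈ betaDomain) (hzim : (f z).im < 0) :
    deriv f z ≠ 0 := by
  have ode : EqOn (fun w => w * (1 - w) * deriv f w)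
      (fun w => ((p - 1) - (p + q - 2) * w) * f w + (p + q - 1)) betaDomain := by
    have hI : I ∈ betaDomain := by simp [betaDomain]
    refine AnalyticOnNhd.eqOn_of_preconnected_of_eventuallyEq (𝕜 := ℂ) (z₀ := I) ?_ ?_
      isPreconnected_betaDomain hI ?_
    · exact (analyticOnNhd_id.mul (analyticOnNhd_const.sub analyticOnNhd_id)).mul hf.deriv
    · exact ((analyticOnNhd_const.sub (analyticOnNhd_const.mul analyticOnNhd_id)).mul hf).add
        analyticOnNhd_const
    · have hU : IsOpen {w : ℂ | 0 < w.im} := isOpen_lt continuous_const continuous_im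
      filter_upwards [hU.mem_nhds (by simp : I ∈ {w : ℂ | 0 < w.im})] with w hw
      have he : f =ᶠ[nhds w] cauchyT (betaMeasure p q) := by
        filter_upwards [hU.mem_nhds hw] with v hv using hagree v hv
      rw [he.deriv_eq, hagree w hw]
      exact deriv_cauchyT_betaMeasure hp hq hw
  intro hd
  have h := ode hzD
  simp only [hd, mul_zero] at h
  have hs : 0 < p + q - 2 := by linarith
  have hn : 0 < normSq (f z) := normSq_pos.2 fun h0 => by simp [h0] at hzim
  have him : (p + q - 2) * z.im * normSq (f z) = -(p + q - 1) * (f z).im := by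
    have h2 : ((p - 1) - (p + q - 2) * z) * normSq (f z) + (p + q - 1) * (starRingEnd ℂ) (f z)
        = 0 := by
      rw [normSq_eq_conj_mul_self]
      linear_combination -(starRingEnd ℂ) (f z) * h
    have := congrArg im h2
    simp at this
    linarith
  have hz : 0 < z.im := by
    by_contra! hz
    have : (p + q - 2) * z.im * normSq (f z) ≤ 0 :=
      mul_nonpos_of_nonpos_of_nonneg (mul_nonpos_of_nonneg_of_nonpos hs.le hz) hn.le
    nlinarith
  have := isProbabilityMeasure_betaMeasure hp hq
  have hle := im_mul_normSq_cauchyT_le (μ := betaMeasure p q) hz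
  rw [← hagree z hz] at hle
  nlinarith [mul_pos hz hn]
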